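/- Let (A,T,n) be a meta-tangible T-triple with unique quasi-negatives such that T is a group under multiplication. Let M be a k×k matrix over A all of whose entries lie in T ∪ {0}, and suppose the rows of M are ∘-dependent: there exist a nonempty set J of row indices and coefficients α_j ∈ T for j ∈ J such that for every column index i, ∑_{j∈J} α_j·M(j,i) ∈ A°. Then det_n(M) ∈ A°, i.e., M is ∘-singular. -/

import Mathlib

/-- The (−)-determinant of a k×k matrix. -/
def detn {A : Type*} [CommSemiring A] (n : A → A) {k : ℕ}
    (M : Matrix (Fin k) (Fin k) A) : A :=
  (∑ σ ∈ Finset.univ.filter (fun σ : Equiv.Perm (Fin k) => Equiv.Perm.sign σ = 1),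
      ∏ i, M (σ i) i)
  + n (∑ σ ∈ Finset.univ.filter (fun σ : Equiv.Perm (Fin k) => Equiv.Perm.sign σ = -1),
      ∏ i, M (σ i) i)

/-- The axioms of a meta-tangible triple with unique quasi-negatives whose tangible elements form a
group. -/
structure IsMetaTangibleGroup {A : Type*} [CommSemiring A] (n : A → A) (T : Set A) : Prop where
  protected map_add : ∀ x y : A, n (x + y) = n x + n y
  map_map : ∀ x : A, n (n x) = x
  protected map_mul : ∀ x y : A, n (x * y) = n x * y
  protected one_mem : (1 : A) ∈ T
  protected mul_mem : ∀ a ∈ T, ∀ b ∈ T, a * b ∈ T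
  map_mem : ∀ a ∈ T, n a ∈ T
  disjoint : ∀ a ∈ T, ¬ ∃ x : A, a = x + n x
  unique : ∀ a ∈ T, ∀ b ∈ T, (∃ x : A, a + b = x + n x) → b = n a
  protected add_mem : ∀ a ∈ T, ∀ b ∈ T, b ≠ n a → a + b ∈ T
  exists_inv : ∀ t ∈ T, ∃ s ∈ T, t * s = 1

/-- A total preorder on `T ∪ {0}` compatible with multiplication, with `0` as strict bottom. -/
structure IsTangibleOrder {A : Type*} [CommSemiring A] (T : Set A) (le : A → A → Prop) : Prop where
  trans : ∀ x y z : A, le x y → le y z → le x z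
  total : ∀ x ∈ insert 0 T, ∀ y ∈ insert 0 T, le x y ∨ le y x
  mul_right : ∀ x y : A, ∀ z ∈ insert 0 T, le x y → le (x * z) (y * z)
  eq_zero : ∀ x : A, le x 0 → x = 0

/-- The sign of a permutation, valued in `{1, n 1}`. -/
def negSign {A : Type*} [CommSemiring A] (n : A → A) {k : ℕ} (σ : Equiv.Perm (Fin k)) : A :=
  if Equiv.Perm.sign σ = 1 then 1 else n 1

/-- `SimplePath W s i j w`: there is a path from `i` to `j` without repeated vertices, with vertex
set `s` and with `w` the product of the values of `W` along its edges. -/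
inductive SimplePath {V A : Type*} [DecidableEq V] [CommSemiring A] (W : V → V → A) :
    Finset V → V → V → A → Prop
  | nil (i : V) : SimplePath W {i} i i 1
  | cons {s : Finset V} {i j : V} {w : A} (x : V) (hx : x ∉ s) (h : SimplePath W s i j w) :
      SimplePath W (insert x s) x j (W x i * w)

namespace SimplePath

variable {V A : Type*} [DecidableEq V] [CommSemiring A] {W : V → V → A}
  {s : Finset V} {i j x : V} {w : A}

lemma left_mem (h : SimplePath W s i j w) : i ∈ s := by
  cases h <;> simp

lemma split (h : SimplePath W s i j w) (hx : x ∈ s) :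
    ∃ s₁ s₂ w₁ w₂, s₁ ⊆ s ∧ SimplePath W s₁ i x w₁ ∧ SimplePath W s₂ x j w₂ ∧ w = w₁ * w₂ := by
  induction h with
  | nil i =>
    obtain rfl := Finset.mem_singleton.1 hx
    exact ⟨_, _, 1, 1, Finset.Subset.refl _, nil x, nil x, by simp⟩
  | @cons s i j w y hy h ih =>
    by_cases hxy : x = y
    · subst hxy
      exact ⟨{x}, _, 1, _, by simp, nil x, cons x hy h, by simp⟩
    · obtain ⟨s₁, s₂, w₁, w₂, hs, h₁, h₂, rfl⟩ := ih (Finset.mem_of_mem_insert_of_ne hx hxy)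
      exact ⟨_, s₂, _, w₂, Finset.insert_subset_insert y hs, cons y (fun hm => hy (hs hm)) h₁, h₂,
        by ring⟩

/-- Closing a simple path gives a permutation. -/
lemma exists_perm [Fintype V] (hW : ∀ v, W v v = 1) (h : SimplePath W s i j w) :
    ∃ σ : Equiv.Perm V, σ i = j ∧ (∀ v ∉ s, σ v = v) ∧
      ∏ v ∈ Finset.univ.erase i, W (σ v) v = w := by
  induction h with
  | nil i => exact ⟨1, rfl, fun _ _ => rfl, Finset.prod_eq_one fun v _ => hW v⟩
  | @cons s i j w x hx h ih =>
    obtain ⟨σ, hσ, hfix, hprod⟩ := ih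
    have hxi : i ≠ x := fun e => hx (e ▸ h.left_mem)
    have hσx : σ x = x := hfix x hx
    refine ⟨σ * Equiv.swap x i, by simp [hσ], ?_, ?_⟩
    · intro v hv
      simp only [Finset.mem_insert, not_or] at hv
      rw [Equiv.Perm.mul_apply, Equiv.swap_apply_of_ne_of_ne hv.1
        (fun e => hv.2 (e ▸ h.left_mem)), hfix v hv.2]
    · have hi : i ∈ Finset.univ.erase x := by simp [hxi]
      have hx' : x ∈ Finset.univ.erase i := by simp [hxi.symm]
      rw [← Finset.mul_prod_erase _ _ hi]
      rw [← Finset.mul_prod_erase _ _ hx', hσx, hW, one_mul] at hprod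
      rw [← hprod, Equiv.Perm.mul_apply, Equiv.swap_apply_right, hσx, Finset.erase_right_comm]
      congr 1
      refine Finset.prod_congr rfl fun v hv => ?_
      simp only [Finset.mem_erase, Finset.mem_univ, and_true] at hv
      rw [Equiv.Perm.mul_apply, Equiv.swap_apply_of_ne_of_ne hv.1 hv.2]

end SimplePath

namespace IsMetaTangibleGroup

variable {A : Type*} [CommSemiring A] {n : A → A} {T : Set A}

lemma map_eq (h : IsMetaTangibleGroup n T) (x : A) : n x = n 1 * x := by
  rw [← h.map_mul, one_mul]

lemma map_one_mul_self (h : IsMetaTangibleGroup n T) : n 1 * n 1 = 1 := by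
  rw [← h.map_eq, h.map_map]

lemma add_map (h : IsMetaTangibleGroup n T) (x : A) : x + n x = x * (1 + n 1) := by
  rw [h.map_eq x]; ring

lemma zero_notMem (h : IsMetaTangibleGroup n T) : (0 : A) ∉ T := fun h0 =>
  h.disjoint 0 h0 ⟨0, by rw [h.map_eq 0]; simp⟩

lemma quasiZero_mul (h : IsMetaTangibleGroup n T) (c : A) {x : A} (hx : ∃ y, x = y + n y) :
    ∃ y, c * x = y + n y := by
  obtain ⟨y, rfl⟩ := hx
  exact ⟨c * y, by rw [h.add_map, h.add_map (c * y), mul_assoc]⟩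

lemma mul_mem_insert (h : IsMetaTangibleGroup n T) {x y : A} (hx : x ∈ insert 0 T)
    (hy : y ∈ insert 0 T) : x * y ∈ insert 0 T := by
  rcases hx with rfl | hx
  · simp
  rcases hy with rfl | hy
  · simp
  exact Or.inr (h.mul_mem _ hx _ hy)

protected lemma prod_mem (h : IsMetaTangibleGroup n T) {ι : Type*} (s : Finset ι) (f : ι → A)
    (hf : ∀ i ∈ s, f i ∈ T) : ∏ i ∈ s, f i ∈ T :=
  Finset.prod_induction f (· ∈ T) (fun a b ha hb => h.mul_mem a ha b hb) h.one_mem hf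

lemma prod_mem_insert (h : IsMetaTangibleGroup n T) {ι : Type*} (s : Finset ι) (f : ι → A)
    (hf : ∀ i ∈ s, f i ∈ insert 0 T) : ∏ i ∈ s, f i ∈ insert 0 T :=
  Finset.prod_induction f (· ∈ insert 0 T) (fun _ _ ha hb => h.mul_mem_insert ha hb)
    (Or.inr h.one_mem) hf

lemma negSign_mem (h : IsMetaTangibleGroup n T) {k : ℕ} (σ : Equiv.Perm (Fin k)) :
    negSign n σ ∈ T := by
  unfold negSign
  split
  · exact h.one_mem
  · exact h.map_mem _ h.one_mem

lemma negSign_mul (h : IsMetaTangibleGroup n T) {k : ℕ} (σ τ : Equiv.Perm (Fin k)) :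
    negSign n (σ * τ) = negSign n σ * negSign n τ := by
  unfold negSign
  rcases Int.units_eq_one_or (Equiv.Perm.sign σ) with hs | hs <;>
    rcases Int.units_eq_one_or (Equiv.Perm.sign τ) with ht | ht <;>
    simp [hs, ht, h.map_one_mul_self]

lemma detn_eq_sum (h : IsMetaTangibleGroup n T) {k : ℕ} (M : Matrix (Fin k) (Fin k) A) :
    detn n M = ∑ σ : Equiv.Perm (Fin k), negSign n σ * ∏ i, M (σ i) i := by
  rw [detn, h.map_eq, Finset.mul_sum, Finset.sum_filter, Finset.sum_filter,
    ← Finset.sum_add_distrib]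
  refine Finset.sum_congr rfl fun σ _ => ?_
  unfold negSign
  rcases Int.units_eq_one_or (Equiv.Perm.sign σ) with hs | hs <;> simp [hs]

/-- Permuting the rows and rescaling rows and columns multiplies the determinant by a factor. -/
lemma detn_rescale (h : IsMetaTangibleGroup n T) {k : ℕ} (M : Matrix (Fin k) (Fin k) A)
    (σ₀ : Equiv.Perm (Fin k)) (q w : Fin k → A) :
    detn n (Matrix.of fun j i => q j * M (σ₀ j) i * w i) =
      negSign n σ₀ * (∏ j, q j) * (∏ i, w i) * detn n M := by
  rw [h.detn_eq_sum, h.detn_eq_sum, Finset.mul_sum]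
  refine Fintype.sum_equiv (Equiv.mulLeft σ₀) _ _ fun σ => ?_
  simp only [Matrix.of_apply, Equiv.coe_mulLeft, h.negSign_mul, Finset.prod_mul_distrib,
    Equiv.Perm.mul_apply]
  rw [Equiv.prod_comp σ q]
  have hs : negSign n σ₀ * negSign n σ₀ = 1 := by
    unfold negSign; split <;> simp [h.map_one_mul_self]
  calc _ = 1 * (negSign n σ * ((∏ j, q j) * (∏ i, M (σ₀ (σ i)) i) * ∏ i, w i)) := by ring
    _ = _ := by rw [← hs]; ring

end IsMetaTangibleGroup

namespace IsTangibleOrder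

variable {A : Type*} [CommSemiring A] {n : A → A} {T : Set A} {le : A → A → Prop}

lemma refl (ho : IsTangibleOrder T le) {x : A} (hx : x ∈ insert 0 T) : le x x :=
  (ho.total x hx x hx).elim id id

lemma mul_left (ho : IsTangibleOrder T le) {x y z : A} (hz : z ∈ insert 0 T) (hxy : le x y) :
    le (z * x) (z * y) := by
  rw [mul_comm z x, mul_comm z y]; exact ho.mul_right x y z hz hxy

lemma exists_greatest (ho : IsTangibleOrder T le) {S : Set A} (hS : S.Finite)
    (hT : ∀ x ∈ S, x ∈ insert 0 T) (hne : S.Nonempty) : ∃ m ∈ S, ∀ x ∈ S, le x m := by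
  induction S, hS using Set.Finite.induction_on with
  | empty => exact absurd hne Set.not_nonempty_empty
  | @insert a S _ _ ih =>
    have ha := hT a (Set.mem_insert a S)
    rcases S.eq_empty_or_nonempty with rfl | hS
    · exact ⟨a, by simp, by simpa using ho.refl ha⟩
    obtain ⟨m, hm, hmax⟩ := ih (fun x hx => hT x (Set.mem_insert_of_mem a hx)) hS
    rcases ho.total a ha m (hT m (Set.mem_insert_of_mem a hm)) with hle | hle
    · exact ⟨m, Set.mem_insert_of_mem a hm, by
        rintro x (rfl | hx)
        exacts [hle, hmax x hx]⟩
    · exact ⟨a, Set.mem_insert a S, by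
        rintro x (rfl | hx)
        exacts [ho.refl ha, ho.trans _ _ _ (hmax x hx) hle]⟩

/-- If no permutation has weight above `1` then `W` admits a potential. -/
lemma exists_potential (ho : IsTangibleOrder T le) (h : IsMetaTangibleGroup n T) {V : Type*}
    [Fintype V] [DecidableEq V] (W : V → V → A) (hW : ∀ i j, W i j ∈ insert 0 T)
    (hdiag : ∀ v, W v v = 1)
    (hperm : ∀ σ : Equiv.Perm V, le (∏ i, W (σ i) i) 1) :
    ∃ p : V → A, (∀ j, p j ∈ T) ∧ ∀ j i, le (W j i * p i) (p j) := by
  have hmem : ∀ {s i j w}, SimplePath W s i j w → w ∈ insert 0 T := by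
    intro s i j w hp
    obtain ⟨σ, -, -, rfl⟩ := hp.exists_perm hdiag
    exact h.prod_mem_insert _ _ fun v _ => hW _ _
  have hex : ∀ j, ∃ m ∈ {w | ∃ s z, SimplePath W s j z w},
      ∀ w ∈ {w | ∃ s z, SimplePath W s j z w}, le w m := by
    intro j
    refine ho.exists_greatest ?_ ?_ ⟨1, {j}, j, .nil j⟩
    · refine (Set.finite_range fun σ : Equiv.Perm V =>
        ∏ v ∈ Finset.univ.erase j, W (σ v) v).subset ?_
      rintro w ⟨s, z, hp⟩
      obtain ⟨σ, -, -, hw⟩ := hp.exists_perm hdiag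
      exact ⟨σ, hw⟩
    · rintro w ⟨s, z, hp⟩
      exact hmem hp
  choose p hp hmax using hex
  have hpT : ∀ j, p j ∈ T := by
    intro j
    obtain ⟨s, z, hpath⟩ := hp j
    refine (hmem hpath).resolve_left fun h0 => ?_
    have h1 := hmax j 1 ⟨{j}, j, .nil j⟩
    rw [h0] at h1
    exact h.zero_notMem (ho.eq_zero 1 h1 ▸ h.one_mem)
  refine ⟨p, hpT, fun j i => ?_⟩
  obtain ⟨s, z, hpath⟩ := hp i
  by_cases hj : j ∈ s
  · obtain ⟨s₁, s₂, w₁, w₂, -, h₁, h₂, hw⟩ := hpath.split hj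
    obtain ⟨σ, hσ, -, hprod⟩ := h₁.exists_perm hdiag
    have hc := hperm σ
    rw [← Finset.mul_prod_erase _ _ (Finset.mem_univ i), hσ, hprod] at hc
    rw [hw, ← mul_assoc]
    exact ho.trans _ w₂ _ (by simpa using ho.mul_right _ _ w₂ (hmem h₂) hc)
      (hmax j w₂ ⟨s₂, z, h₂⟩)
  · exact hmax j _ ⟨_, z, .cons j hj hpath⟩

/-- It suffices to treat matrices with entries at most `1`, with diagonal `1`, and with a dependence
whose coefficients are at most `1`, one of them being `1`. -/
lemma detn_quasiZero_of_normalized (ho : IsTangibleOrder T le) (h : IsMetaTangibleGroup n T)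
    {k : ℕ}
    (H : ∀ (M : Matrix (Fin k) (Fin k) A) (J : Finset (Fin k)) (α : Fin k → A) (j₀ : Fin k),
      (∀ i j, M i j ∈ insert 0 T) → (∀ i j, le (M i j) 1) → (∀ i, M i i = 1) →
      j₀ ∈ J → α j₀ = 1 → (∀ j ∈ J, α j ∈ T) → (∀ j ∈ J, le (α j) 1) →
      (∀ i, ∃ x, ∑ j ∈ J, α j * M j i = x + n x) → ∃ x, detn n M = x + n x)
    (M : Matrix (Fin k) (Fin k) A) (J : Finset (Fin k)) (hJ : J.Nonempty) (α : Fin k → A)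
    (hM : ∀ i j, M i j ∈ insert 0 T) (hα : ∀ j ∈ J, α j ∈ T)
    (hdep : ∀ i, ∃ x, ∑ j ∈ J, α j * M j i = x + n x) : ∃ x, detn n M = x + n x := by
  have hprodmem : ∀ σ : Equiv.Perm (Fin k), ∏ i, M (σ i) i ∈ insert 0 T := fun σ =>
    h.prod_mem_insert _ _ fun i _ => hM _ _
  obtain ⟨_, ⟨σ₀, rfl⟩, hmax⟩ := ho.exists_greatest
    (Set.finite_range fun σ : Equiv.Perm (Fin k) => ∏ i, M (σ i) i)
    (by rintro _ ⟨σ, rfl⟩; exact hprodmem σ) (Set.range_nonempty _)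
  by_cases hzero : ∏ i, M (σ₀ i) i = 0
  · refine ⟨0, ?_⟩
    rw [h.detn_eq_sum, h.map_eq 0, mul_zero, add_zero]
    refine Finset.sum_eq_zero fun σ _ => ?_
    have h0 := hmax _ ⟨σ, rfl⟩
    simp only [hzero] at h0
    rw [ho.eq_zero _ h0, mul_zero]
  have hd : ∀ i, M (σ₀ i) i ∈ T := fun i =>
    (hM _ _).resolve_left fun h0 => hzero (Finset.prod_eq_zero (Finset.mem_univ i) h0)
  choose t ht hdt using fun i => h.exists_inv _ (hd i)
  obtain ⟨p, hp, hpW⟩ := ho.exists_potential h (fun j i => M (σ₀ j) i * t i)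
    (fun j i => h.mul_mem_insert (hM _ _) (Or.inr (ht i))) hdt (by
      intro σ
      have h1 := ho.mul_right _ _ (∏ i, t i) (Or.inr (h.prod_mem _ _ fun i _ => ht i))
        (hmax _ ⟨σ₀ * σ, rfl⟩)
      simp only [← Finset.prod_mul_distrib, hdt, Finset.prod_const_one] at h1
      exact h1)
  choose q hq hpq using fun j => h.exists_inv _ (hp j)
  set N : Matrix (Fin k) (Fin k) A :=
    Matrix.of fun j i => q j * M (σ₀ j) i * (t i * p i) with hN
  set J' : Finset (Fin k) := J.map σ₀.symm.toEmbedding with hJ'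
  have hJ'mem : ∀ j ∈ J', α (σ₀ j) * p j ∈ T := by
    intro j hj
    obtain ⟨j', hj', rfl⟩ := Finset.mem_map.1 hj
    exact h.mul_mem _ (hα _ (by simpa using hj')) _ (hp _)
  obtain ⟨_, ⟨j₀, hj₀, rfl⟩, hj₀max⟩ := ho.exists_greatest
    (J'.finite_toSet.image fun j => α (σ₀ j) * p j)
    (by rintro _ ⟨j, hj, rfl⟩; exact Or.inr (hJ'mem j hj)) ((Finset.coe_nonempty.2
      (Finset.map_nonempty.2 hJ)).image _)
  obtain ⟨c, hc, hcmul⟩ := h.exists_inv _ (hJ'mem j₀ hj₀)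
  have key : ∃ x, detn n N = x + n x := by
    refine H N J' (fun j => α (σ₀ j) * p j * c) j₀ ?_ ?_ ?_ hj₀ hcmul ?_ ?_ ?_
    · intro j i
      exact h.mul_mem_insert (h.mul_mem_insert (Or.inr (hq j)) (hM _ _))
        (h.mul_mem_insert (Or.inr (ht i)) (Or.inr (hp i)))
    · intro j i
      have h1 := ho.mul_left (Or.inr (hq j)) (hpW j i)
      rw [mul_comm (q j) (p j), hpq] at h1
      rw [hN, Matrix.of_apply]
      convert h1 using 1
      ring
    · intro i
      calc q i * M (σ₀ i) i * (t i * p i) = (M (σ₀ i) i * t i) * (p i * q i) := by ring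
        _ = 1 := by rw [hdt, hpq, one_mul]
    · intro j hj
      exact h.mul_mem _ (hJ'mem j hj) _ hc
    · intro j hj
      rw [← hcmul]
      exact ho.mul_right _ _ c (Or.inr hc) (hj₀max _ ⟨j, hj, rfl⟩)
    · intro i
      obtain ⟨x, hx⟩ := h.quasiZero_mul (c * (t i * p i)) (hdep i)
      refine ⟨x, hx ▸ ?_⟩
      rw [hJ', Finset.sum_map, Finset.mul_sum]
      refine Finset.sum_congr rfl fun j _ => ?_
      simp only [hN, Matrix.of_apply, Equiv.coe_toEmbedding, Equiv.apply_symm_apply]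
      calc _ = α j * c * M j i * (t i * p i) * (p (σ₀.symm j) * q (σ₀.symm j)) := by ring
        _ = _ := by rw [hpq]; ring
  rw [hN, h.detn_rescale] at key
  have hf : negSign n σ₀ * (∏ j, q j) * (∏ i, t i * p i) ∈ T :=
    h.mul_mem _ (h.mul_mem _ (h.negSign_mem _) _ (h.prod_mem _ _ fun i _ => hq i)) _
      (h.prod_mem _ _ fun i _ => h.mul_mem _ (ht i) _ (hp i))
  obtain ⟨g, -, hg⟩ := h.exists_inv _ hf
  obtain ⟨x, hx⟩ := h.quasiZero_mul g key
  refine ⟨x, hx ▸ ?_⟩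
  rw [← mul_assoc, mul_comm g, hg, one_mul]

end IsTangibleOrder

lemma Matrix.det_eq_zero_of_vecMul_eq_zero {ι R : Type*} [Fintype ι] [DecidableEq ι] [CommRing R]
    {B : Matrix ι ι R} {v : ι → R} {j : ι} (hv : Matrix.vecMul v B = 0) (hj : v j = 1) :
    B.det = 0 := by
  have h1 : Matrix.vecMul (Matrix.vecMul v B) B.adjugate = B.det • v := by
    rw [Matrix.vecMul_vecMul, Matrix.mul_adjugate, Matrix.vecMul_smul, Matrix.vecMul_one]
  rw [hv, Matrix.zero_vecMul] at h1
  simpa [hj] using (congrFun h1 j).symm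

namespace IsMetaTangibleGroup

variable {A : Type*} [CommSemiring A] {n : A → A} {T : Set A}

lemma mul_self_eq (h : IsMetaTangibleGroup n T) :
    (1 + n 1) * (1 + n 1) = (1 + n 1) + (1 + n 1) := by
  have := h.map_one_mul_self
  calc (1 + n 1) * (1 + n 1) = 1 + n 1 + n 1 + n 1 * n 1 := by ring
    _ = _ := by rw [this]; ring

lemma map_one_mul (h : IsMetaTangibleGroup n T) : n 1 * (1 + n 1) = 1 + n 1 := by
  rw [mul_add, h.map_one_mul_self]; ring

/-- The order by size of `x * (1 + n 1)`. -/
lemma isTangibleOrder_of_idem (h : IsMetaTangibleGroup n T)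
    (hee : (1 + n 1) + (1 + n 1) = 1 + n 1) :
    IsTangibleOrder T fun x y =>
      x = 0 ∨ (y ≠ 0 ∧ x * (1 + n 1) + y * (1 + n 1) = y * (1 + n 1)) where
  trans x y z := by
    rintro (rfl | ⟨hy, hxy⟩)
    · simp
    rintro (rfl | ⟨hz, hyz⟩)
    · exact absurd rfl hy
    · exact Or.inr ⟨hz, by rw [← hyz, ← add_assoc, hxy]⟩
  total x hx y hy := by
    rcases hx with rfl | hx
    · simp
    rcases hy with rfl | hy
    · simp
    have hx0 : x ≠ 0 := fun e => h.zero_notMem (e ▸ hx)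
    have hy0 : y ≠ 0 := fun e => h.zero_notMem (e ▸ hy)
    have hn : ∀ z, n z * (1 + n 1) = z * (1 + n 1) := by
      intro z
      rw [h.map_eq z, mul_comm (n 1), mul_assoc, h.map_one_mul]
    have hid : ∀ z, z * (1 + n 1) + z * (1 + n 1) = z * (1 + n 1) := by
      intro z
      rw [← mul_add, hee]
    have hme := h.mul_self_eq.trans hee
    by_cases hyx : y = n x
    · subst hyx
      exact Or.inl (Or.inr ⟨hy0, by rw [hn, hid]⟩)
    have hs := h.add_mem x hx y hy hyx
    by_cases hyx' : n y = n (x + y)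
    · have : y = x + y := by
        have h2 := congrArg n hyx'
        rwa [h.map_map, h.map_map] at h2
      exact Or.inl (Or.inr ⟨hy0, by rw [← add_mul, ← this]⟩)
    have hd := h.add_mem _ hs _ (h.map_mem y hy) hyx'
    have hnx : n x = n (x + y + n y) := by
      refine h.unique _ hd _ (h.map_mem x hx) ⟨x + y, ?_⟩
      rw [h.map_add]; ring
    have hxe : x + y * (1 + n 1) = x := by
      rw [← h.add_map, ← add_assoc, ← h.map_map (x + y + n y), ← hnx, h.map_map]
    refine Or.inr (Or.inr ⟨hx0, ?_⟩)
    conv_rhs => rw [← hxe]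
    rw [add_mul, mul_assoc y, hme, add_comm]
  mul_right x y z hz := by
    rintro (rfl | ⟨hy, hxy⟩)
    · simp
    rcases hz with rfl | hz
    · simp
    refine Or.inr ⟨fun h0 => hy ?_, ?_⟩
    · obtain ⟨w, -, hw⟩ := h.exists_inv z hz
      rw [← mul_one y, ← hw, ← mul_assoc, h0, zero_mul]
    · calc _ = (x * (1 + n 1) + y * (1 + n 1)) * z := by ring
        _ = _ := by rw [hxy]; ring
  eq_zero x := by simp

/-- When `e` is an additively idempotent element with `1 + e = 1`, the elements absorbing `e` form a
ring with zero `e`. -/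
@[reducible] def residueRing {e m : A} (h1 : 1 + e = 1) (hee : e + e = e) (hme : e * e = e)
    (hm : m * e = e) (hm1 : m + 1 = e) : CommRing {x : A // x + e = x ∧ x * e = e} :=
  letI : Add {x : A // x + e = x ∧ x * e = e} :=
    ⟨fun x y => ⟨x + y, by rw [add_assoc, y.2.1], by rw [add_mul, x.2.2, y.2.2, hee]⟩⟩
  letI : Mul {x : A // x + e = x ∧ x * e = e} := ⟨fun x y => ⟨x * y, by
    nth_rw 2 [← y.2.1]
    rw [mul_add, x.2.2], by rw [mul_assoc, y.2.2, x.2.2]⟩⟩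
  letI : Neg {x : A // x + e = x ∧ x * e = e} := ⟨fun x => ⟨m * x, by
    nth_rw 2 [← x.2.1]
    rw [mul_add, hm], by rw [mul_assoc, x.2.2, hm]⟩⟩
  letI : Zero {x : A // x + e = x ∧ x * e = e} := ⟨⟨e, hee, hme⟩⟩
  letI : One {x : A // x + e = x ∧ x * e = e} := ⟨⟨1, h1, one_mul _⟩⟩
  CommRing.ofMinimalAxioms
    (fun _ _ _ => Subtype.ext (add_assoc _ _ _))
    (fun x => Subtype.ext ((add_comm _ _).trans x.2.1))
    (fun x => Subtype.ext (by
      change m * x.1 + x.1 = e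
      rw [← add_one_mul, hm1, mul_comm, x.2.2]))
    (fun _ _ _ => Subtype.ext (mul_assoc _ _ _))
    (fun _ _ => Subtype.ext (mul_comm _ _))
    (fun _ => Subtype.ext (one_mul _))
    (fun _ _ _ => Subtype.ext (mul_add _ _ _))

/-- The elements of size at most `1`. -/
def integers {e : A} (hee : e + e = e) : Subsemiring A where
  carrier := {x | x * e + e = e}
  zero_mem' := by simp
  one_mem' := by simpa using hee
  add_mem' {x y} hx hy := by
    simp only [Set.mem_ofPred_eq] at hx hy ⊢
    rw [add_mul, add_assoc, hy, hx]
  mul_mem' {x y} hx hy := by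
    simp only [Set.mem_ofPred_eq] at hx hy ⊢
    calc x * y * e + e = x * (y * e) + (x * e + e) := by rw [hx]; ring
      _ = x * (y * e + e) + e := by ring
      _ = _ := by rw [hy, hx]

lemma mem_integers {e : A} {hee : e + e = e} {x : A} :
    x ∈ integers hee ↔ x * e + e = e := Iff.rfl

/-- Reduction of the elements of size at most `1` to the residue ring. -/
def residueMap {e m : A} (h1 : 1 + e = 1) (hee : e + e = e) (hme : e * e = e)
    (hm : m * e = e) (hm1 : m + 1 = e) :
    letI := residueRing h1 hee hme hm hm1
    integers hee →+* {x : A // x + e = x ∧ x * e = e} :=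
  letI := residueRing h1 hee hme hm hm1
  { toFun x := ⟨x + e, by rw [add_assoc, hee],
        by rw [add_mul, hme]; exact mem_integers.1 x.2⟩
    map_one' := Subtype.ext h1
    map_zero' := Subtype.ext (zero_add _)
    map_add' x y := Subtype.ext (by
      change (x + y : A) + e = (x + e) + (y + e)
      rw [add_add_add_comm, hee])
    map_mul' x y := Subtype.ext (by
      change (x * y : A) + e = (x + e) * (y + e)
      have hx := mem_integers.1 x.2
      have hy := mem_integers.1 y.2
      rw [add_mul, mul_add, mul_add, hme, mul_comm e (y : A), hy, add_assoc, hx]) }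

lemma detn_quasiZero_of_residue (h : IsMetaTangibleGroup n T) (h1 : 1 + (1 + n 1) = 1)
    (hee : (1 + n 1) + (1 + n 1) = 1 + n 1) {k : ℕ} (M : Matrix (Fin k) (Fin k) A)
    (J : Finset (Fin k)) (α : Fin k → A) (j₀ : Fin k) (hM : ∀ i j, M i j ∈ integers hee)
    (hdiag : ∀ i, M i i = 1) (hj₀ : j₀ ∈ J) (hα₀ : α j₀ = 1)
    (hα : ∀ j ∈ J, α j ∈ integers hee)
    (hdep : ∀ i, ∃ x, ∑ j ∈ J, α j * M j i = x + n x) : ∃ x, detn n M = x + n x := by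
  have hme := h.mul_self_eq.trans hee
  have hm1 := add_comm (n 1) (1 : A)
  let := residueRing h1 hee hme h.map_one_mul hm1
  let r := residueMap h1 hee hme h.map_one_mul hm1
  have hr : ∀ x, (r x : A) = x + (1 + n 1) := fun _ => rfl
  let M' : Fin k → Fin k → integers hee := fun j i => ⟨M j i, hM j i⟩
  let a : Fin k → integers hee := fun j => if hj : j ∈ J then ⟨α j, hα j hj⟩ else 0
  have hs : ∀ σ : Equiv.Perm (Fin k), negSign n σ ∈ integers hee := by
    intro σ
    unfold negSign
    split
    · exact (integers hee).one_mem
    · rw [mem_integers, h.map_one_mul, hee]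
  let d : integers hee := ∑ σ : Equiv.Perm (Fin k), ⟨negSign n σ, hs σ⟩ * ∏ i, M' (σ i) i
  have hd : (d : A) = detn n M := by
    rw [h.detn_eq_sum]
    simp [d, M']
  have hdet : r d = (Matrix.of fun j i => r (M' j i)).det := by
    rw [Matrix.det_apply', map_sum]
    refine Finset.sum_congr rfl fun σ _ => ?_
    simp only [Matrix.of_apply]
    rw [map_mul r, map_prod r]
    refine congrArg (· * _) ?_
    rcases Int.units_eq_one_or (Equiv.Perm.sign σ) with hσ | hσ
    · simp only [hσ, negSign, if_true, Units.val_one, Int.cast_one]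
      exact Subtype.ext h1
    · simp only [hσ, negSign, Units.val_neg, Units.val_one, Int.cast_neg, Int.cast_one]
      refine Subtype.ext ?_
      change (if (-1 : ℤˣ) = 1 then 1 else n 1) + (1 + n 1) = n 1 * 1
      rw [if_neg (by decide)]
      have h2 := congrArg (n 1 * ·) h1
      simp only [mul_add, h.map_one_mul_self, mul_one] at h2
      rw [add_comm 1, h2, mul_one]
  have hdet0 : r d = 0 := by
    rw [hdet]
    refine Matrix.det_eq_zero_of_vecMul_eq_zero (v := fun j => r (a j)) (j := j₀) ?_ ?_
    · funext i
      have hsum : Matrix.vecMul (fun j => r (a j)) (Matrix.of fun j i => r (M' j i)) i =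
          r (∑ j, a j * M' j i) := by
        simp [Matrix.vecMul, dotProduct]
      rw [hsum]
      have hA : ((∑ j, a j * M' j i : integers hee) : A) = ∑ j ∈ J, α j * M j i := by
        rw [AddSubmonoidClass.coe_finsetSum]
        refine (Finset.sum_subset_zero_on_sdiff (Finset.subset_univ J) ?_ ?_).symm
        · intro j hj
          simp [a, (Finset.mem_sdiff.1 hj).2]
        · intro j hj
          simp [a, hj, M']
      refine Subtype.ext ?_
      rw [hr]
      have hO := mem_integers.1 (∑ j, a j * M' j i).2
      rw [hA] at hO ⊢
      obtain ⟨x, hx⟩ := hdep i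
      rw [h.add_map] at hx
      rw [hx, mul_assoc, hme] at hO
      rw [hx, hO]
      rfl
    · simp only [a, dif_pos hj₀]
      refine Subtype.ext ?_
      rw [hr]
      change α j₀ + (1 + n 1) = 1
      rw [hα₀, h1]
  have hd0 : detn n M + (1 + n 1) = 1 + n 1 := by
    rw [← hd]; exact congrArg Subtype.val hdet0
  have hde : detn n M * (1 + n 1) = 1 + n 1 := by
    rw [← hd]
    simp only [d]
    rw [← Finset.add_sum_erase _ _ (Finset.mem_univ 1)]
    have hone : (⟨negSign n 1, hs 1⟩ * ∏ i, M' ((1 : Equiv.Perm (Fin k)) i) i : integers hee) =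
        1 := by
      refine Subtype.ext ?_
      simp [M', negSign, hdiag]
    rw [hone]
    set c : integers hee := _
    change (1 + (c : A)) * (1 + n 1) = _
    rw [add_mul, one_mul, add_comm]
    exact mem_integers.1 c.2
  refine ⟨1, ?_⟩
  rw [← hd0, ← hde, ← mul_one_add, h1, mul_one]

end IsMetaTangibleGroup

/-- A self-map of a finite set that preserves `P` and moves every point of `P` contains a cycle. -/
lemma exists_isCycle_of_map {V : Type*} [Fintype V] [DecidableEq V] (f : V → V) (P : V → Prop)
    (hP : ∀ i, P i → P (f i) ∧ f i ≠ i) (i₀ : V) (h₀ : P i₀) :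
    ∃ τ : Equiv.Perm V, τ.IsCycle ∧ ∀ i ∈ τ.support, P i ∧ τ i = f i := by
  have hiter : ∀ m i, P i → P (f^[m] i) := by
    intro m
    induction m with
    | zero => exact fun _ hi => hi
    | succ m ih => exact fun i hi => ih _ (hP i hi).1
  obtain ⟨x, hPx, hx⟩ : ∃ x, P x ∧ x ∈ Function.periodicPts f := by
    obtain ⟨a, b, hab, he⟩ := Finite.exists_ne_map_eq_of_infinite fun m => f^[m] i₀
    wlog hlt : a < b generalizing a b
    · exact this b a hab.symm he.symm (lt_of_le_of_ne (not_lt.1 hlt) hab.symm)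
    refine ⟨f^[a] i₀, hiter a i₀ h₀, b - a, by omega, ?_⟩
    change f^[b - a] (f^[a] i₀) = f^[a] i₀
    rw [← Function.iterate_add_apply, Nat.sub_add_cancel hlt.le]
    exact he.symm
  classical
  let g : Equiv.Perm (Function.periodicPts f) := (Function.bijOn_periodicPts f).equiv f
  let π : Equiv.Perm V := Equiv.Perm.ofSubtype g
  have hπ : ∀ y ∈ Function.periodicPts f, π y = f y ∧ f y ∈ Function.periodicPts f := by
    intro y hy
    refine ⟨?_, (Function.bijOn_periodicPts f).mapsTo hy⟩
    simp only [π]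
    rw [Equiv.Perm.ofSubtype_apply_of_mem g hy]
    rfl
  have hpow : ∀ m : ℕ, P ((π ^ m) x) ∧ (π ^ m) x ∈ Function.periodicPts f := by
    intro m
    induction m with
    | zero => exact ⟨hPx, hx⟩
    | succ m ih =>
      rw [pow_succ', Equiv.Perm.mul_apply, (hπ _ ih.2).1]
      exact ⟨(hP _ ih.1).1, (hπ _ ih.2).2⟩
  refine ⟨π.cycleOf x, Equiv.Perm.isCycle_cycleOf π ?_, fun i hi => ?_⟩
  · rw [(hπ x hx).1]
    exact (hP x hPx).2
  · obtain ⟨hsc, -⟩ := Equiv.Perm.mem_support_cycleOf_iff.1 hi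
    rw [hsc.cycleOf_apply]
    obtain ⟨m, -, -, rfl⟩ := hsc.exists_pow_eq'
    exact ⟨(hpow m).1, (hπ _ (hpow m).2).1⟩

namespace IsMetaTangibleGroup

variable {A : Type*} [CommSemiring A] {n : A → A} {T : Set A}

/-- Among tangible elements in the idempotent case, addition returns the larger summand unless the
summands are quasi-negatives of each other. -/
lemma add_eq_left_of_idem (h : IsMetaTangibleGroup n T) (h11 : (1 : A) + 1 = 1) {x y : A}
    (hx : x ∈ T) (hy : y ∈ T) (hyx : y ≠ n x)
    (hle : y * (1 + n 1) + x * (1 + n 1) = x * (1 + n 1)) : x + y = x := by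
  have he1 : 1 + (1 + n 1) = 1 + n 1 := by rw [← add_assoc, h11]
  have hee : (1 + n 1) + (1 + n 1) = 1 + n 1 := by
    have h2 : n 1 + n 1 = n 1 := by rw [← h.map_add, h11]
    calc (1 + n 1) + (1 + n 1) = (1 + 1) + (n 1 + n 1) := by ring
      _ = _ := by rw [h11, h2]
  have hme := h.mul_self_eq.trans hee
  by_contra hne
  have hs := h.add_mem x hx y hy hyx
  have hd : x + y + n x ∈ T := by
    refine h.add_mem _ hs _ (h.map_mem x hx) fun e => hne ?_
    have h2 := congrArg n e
    rw [h.map_map, h.map_map] at h2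
    exact h2.symm
  have hq : x + y + n x = y := by
    have h2 : n y = n (x + y + n x) := by
      refine h.unique _ hd _ (h.map_mem y hy) ⟨x, ?_⟩
      rw [h.add_map x, ← hle, ← h.add_map, ← h.add_map]; ring
    have h3 := congrArg n h2
    rwa [h.map_map, h.map_map, eq_comm] at h3
  have hyx2 : y + x * (1 + n 1) = y := by
    rw [← h.add_map]
    calc y + (x + n x) = x + y + n x := by ring
      _ = y := hq
  have hxe : x * (1 + n 1) = y * (1 + n 1) := by
    have h2 := congrArg (· * (1 + n 1)) hyx2
    simp only [add_mul y, mul_assoc x, hme] at h2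
    rw [← hle, h2]
  rw [hxe] at hyx2
  refine h.disjoint y hy ⟨y, ?_⟩
  rw [h.add_map, ← he1, mul_add, mul_one, hyx2]

lemma detn_quasiZero_of_signed (h : IsMetaTangibleGroup n T) (h11 : (1 : A) + 1 = 1)
    (hn1 : n 1 ≠ 1) {k : ℕ} (M : Matrix (Fin k) (Fin k) A)
    (J : Finset (Fin k)) (α : Fin k → A) (j₀ : Fin k)
    (hMT : ∀ i j, M i j ∈ insert 0 T)
    (hM : ∀ i j, M i j * (1 + n 1) + (1 + n 1) = 1 + n 1)
    (hdiag : ∀ i, M i i = 1) (hj₀ : j₀ ∈ J) (hα₀ : α j₀ = 1)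
    (hαT : ∀ j ∈ J, α j ∈ T) (hα : ∀ j ∈ J, α j * (1 + n 1) + (1 + n 1) = 1 + n 1)
    (hdep : ∀ i, ∃ x, ∑ j ∈ J, α j * M j i = x + n x) : ∃ x, detn n M = x + n x := by
  have hn11 : n 1 + n 1 = n 1 := by rw [← h.map_add, h11]
  have hee : (1 + n 1) + (1 + n 1) = 1 + n 1 := by
    calc (1 + n 1) + (1 + n 1) = (1 + 1) + (n 1 + n 1) := by ring
      _ = _ := by rw [h11, hn11]
  have hsize : ∀ x, x * (1 + n 1) + (1 + n 1) = 1 + n 1 ↔ x ∈ integers hee := fun _ => Iff.rfl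
  -- every row index of full size has a cancelling partner
  have hpartner : ∀ i, i ∈ J ∧ α i * (1 + n 1) = 1 + n 1 →
      ∃ j, (j ∈ J ∧ α j * (1 + n 1) = 1 + n 1) ∧ α j * M j i = n 1 * α i := by
    rintro i ⟨hi, hie⟩
    have hex : ∃ j ∈ J, α j * M j i = n (α i) := by
      by_contra! hno
      have hsum : ∀ s ⊆ J, α i + ∑ j ∈ s, α j * M j i = α i := by
        intro s
        induction s using Finset.induction_on with
        | empty => simp
        | insert j s hj ih =>
          intro hs
          have hjJ := hs (Finset.mem_insert_self j s)
          rw [Finset.sum_insert hj, add_left_comm, ih fun x hx => hs (Finset.mem_insert_of_mem hx),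
            add_comm]
          rcases hMT j i with h0 | hT
          · rw [h0, mul_zero, add_zero]
          · refine h.add_eq_left_of_idem h11 (hαT i hi) (h.mul_mem _ (hαT j hjJ) _ hT)
              (hno j hjJ) ?_
            rw [hie]
            exact (hsize _).2 (mul_mem ((hsize _).1 (hα j hjJ)) ((hsize _).1 (hM j i)))
      obtain ⟨x, hx⟩ := hdep i
      refine h.disjoint _ (hαT i hi) ⟨x, ?_⟩
      rw [← hx]
      have h1 := hsum (J.erase i) (Finset.erase_subset _ _)
      rw [← Finset.add_sum_erase _ _ hi, hdiag, mul_one, h1]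
    obtain ⟨j, hj, hji⟩ := hex
    refine ⟨j, ⟨hj, ?_⟩, by rw [hji, h.map_eq]⟩
    have h1 : α j * (M j i * (1 + n 1)) = 1 + n 1 := by
      rw [← mul_assoc, hji, h.map_eq, mul_assoc, hie, h.map_one_mul]
    have h2 := congrArg (α j * ·) (hM j i)
    simp only [mul_add (α j) (M j i * (1 + n 1)), h1] at h2
    rw [← h2, add_comm, hα j hj]
  -- follow partners to a cycle
  obtain ⟨τ, hτ, hτc⟩ : ∃ τ : Equiv.Perm (Fin k), τ.IsCycle ∧
      ∀ i ∈ τ.support, i ∈ J ∧ α (τ i) * M (τ i) i = n 1 * α i := by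
    choose! f hf using hpartner
    have hne : ∀ i, i ∈ J ∧ α i * (1 + n 1) = 1 + n 1 → f i ≠ i := by
      intro i hi hfi
      obtain ⟨g, -, hg⟩ := h.exists_inv _ (hαT i hi.1)
      have h1 := congrArg (· * g) (hf i hi).2
      simp only [hfi, hdiag, mul_one, hg, mul_assoc] at h1
      exact hn1 h1.symm
    obtain ⟨τ, hτ, hτf⟩ := exists_isCycle_of_map f (fun i => i ∈ J ∧ α i * (1 + n 1) = 1 + n 1)
      (fun i hi => ⟨(hf i hi).1, hne i hi⟩) j₀ ⟨hj₀, by rw [hα₀, one_mul]⟩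
    refine ⟨τ, hτ, fun i hi => ⟨(hτf i hi).1.1, ?_⟩⟩
    rw [(hτf i hi).2]
    exact (hf i (hτf i hi).1).2
  have hτ1 : τ ≠ 1 := hτ.ne_one
  have hterm : negSign n τ * ∏ i, M (τ i) i = n 1 := by
    have hprod : ∏ i, M (τ i) i = ∏ i ∈ τ.support, M (τ i) i := by
      refine (Finset.prod_subset (Finset.subset_univ _) fun i _ hi => ?_).symm
      rw [Equiv.Perm.notMem_support.1 hi, hdiag]
    have h1 : (∏ i ∈ τ.support, α i) * ∏ i ∈ τ.support, M (τ i) i =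
        (∏ i ∈ τ.support, α i) * n 1 ^ τ.support.card := by
      have h2 : ∏ i ∈ τ.support, α (τ i) = ∏ i ∈ τ.support, α i :=
        Finset.prod_equiv τ (by simp) (by simp)
      nth_rw 1 [← h2]
      rw [← Finset.prod_const, ← Finset.prod_mul_distrib, ← Finset.prod_mul_distrib]
      exact Finset.prod_congr rfl fun i hi => by rw [(hτc i hi).2, mul_comm]
    obtain ⟨g, -, hg⟩ := h.exists_inv _ (h.prod_mem _ _ fun i hi => hαT i (hτc i hi).1)
    have h3 : ∏ i ∈ τ.support, M (τ i) i = n 1 ^ τ.support.card := by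
      have h4 : ∀ y, y = g * ((∏ i ∈ τ.support, α i) * y) := fun y => by
        rw [← mul_assoc, mul_comm g, hg, one_mul]
      rw [h4 (∏ i ∈ τ.support, M (τ i) i), h1, ← h4]
    rw [hprod, h3, negSign, hτ.sign]
    rcases Nat.even_or_odd τ.support.card with he | ho
    · rw [he.neg_one_pow, if_neg (by decide), he.two_dvd.choose_spec, pow_mul, sq,
        h.map_one_mul_self, one_pow, mul_one]
    · rw [ho.neg_one_pow, if_pos (by decide), one_mul, ho.choose_spec, pow_add, pow_mul, sq,
        h.map_one_mul_self, one_pow, one_mul, pow_one]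
  have habs : ∀ s : Finset (Equiv.Perm (Fin k)),
      (1 + n 1) + ∑ σ ∈ s, negSign n σ * ∏ i, M (σ i) i = 1 + n 1 := by
    intro s
    induction s using Finset.induction_on with
    | empty => simp
    | insert σ s hσ ih =>
      rw [Finset.sum_insert hσ, add_left_comm, ih, add_comm]
      have hle : (∏ i, M (σ i) i) ∈ integers hee := prod_mem fun i _ => (hsize _).1 (hM _ _)
      rcases h.prod_mem_insert Finset.univ (fun i => M (σ i) i) fun i _ => hMT _ _ with h0 | hT
      · rw [h0, mul_zero, add_zero]
      have hT' := h.mul_mem _ (h.negSign_mem σ) _ hT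
      have hle' : negSign n σ * ∏ i, M (σ i) i ∈ integers hee := by
        refine mul_mem ?_ hle
        unfold negSign
        split
        · exact (integers hee).one_mem
        · rw [mem_integers, h.map_one_mul, hee]
      by_cases hc : negSign n σ * ∏ i, M (σ i) i = n 1
      · rw [hc, add_assoc, hn11]
      · rw [add_right_comm, h.add_eq_left_of_idem h11 h.one_mem hT' hc (by
          rw [one_mul]; exact hle')]
  refine ⟨1, ?_⟩
  rw [h.detn_eq_sum, ← Finset.add_sum_erase _ _ (Finset.mem_univ 1),
    ← Finset.add_sum_erase (Finset.univ.erase 1) _ (Finset.mem_erase.2 ⟨hτ1, Finset.mem_univ _⟩),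
    hterm, ← add_assoc]
  have h1 : negSign n (1 : Equiv.Perm (Fin k)) *
      ∏ i, M ((1 : Equiv.Perm (Fin k)) i) i = 1 := by
    simp [negSign, hdiag]
  rw [h1, habs]

end IsMetaTangibleGroup

section TightPerm

variable {V : Type*} [Fintype V] {E : V → V → Prop}

/-- A walk in a reflexive relation gives a permutation which closes it up. -/
lemma exists_perm_of_reflTransGen [DecidableEq V] (hE : ∀ v, E v v) {i j : V}
    (hij : Relation.ReflTransGen E i j) :
    ∃ σ : Equiv.Perm V, σ i = j ∧ ∀ v, v ≠ i → E (σ v) v := by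
  classical
  let W : V → V → ℕ := fun x y => if E x y then 1 else 0
  obtain ⟨s, hs⟩ : ∃ s, SimplePath W s i j 1 := by
    induction hij using Relation.ReflTransGen.head_induction_on with
    | refl => exact ⟨_, .nil j⟩
    | @head a c hac _ ih =>
      obtain ⟨s, hs⟩ := ih
      by_cases ha : a ∈ s
      · obtain ⟨_, s₂, _, w₂, -, -, h₂, hw⟩ := hs.split ha
        obtain rfl := Nat.eq_one_of_mul_eq_one_left hw.symm
        exact ⟨s₂, h₂⟩
      · have hc := SimplePath.cons a ha hs
        rw [show W a c = 1 from if_pos hac, one_mul] at hc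
        exact ⟨_, hc⟩
  obtain ⟨σ, hσ, -, hprod⟩ := hs.exists_perm fun v => (if_pos (hE v) : W v v = 1)
  refine ⟨σ, hσ, fun v hv => ?_⟩
  by_contra hno
  rw [Finset.prod_eq_zero (Finset.mem_erase.2 ⟨hv, Finset.mem_univ v⟩) (if_neg hno)] at hprod
  exact zero_ne_one hprod

lemma reflTransGen_of_perm {σ : Equiv.Perm V} (hσ : ∀ v, E (σ v) v) (v : V) :
    Relation.ReflTransGen E v (σ v) := by
  have hpow : ∀ (m : ℕ) (x : V), Relation.ReflTransGen E ((σ ^ m) x) x := by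
    intro m
    induction m with
    | zero => exact fun x => .refl
    | succ m ih =>
      intro x
      rw [pow_succ', Equiv.Perm.mul_apply]
      exact .head (hσ _) (ih x)
  have h1 := hpow (orderOf σ - 1) (σ v)
  rwa [← Equiv.Perm.mul_apply, ← pow_succ, Nat.sub_add_cancel (orderOf_pos σ), pow_orderOf_eq_one,
    Equiv.Perm.one_apply] at h1

open scoped Classical in
/-- The number of permutations supported on a reflexive relation is even or is at least some odd
column count of any given nonempty set of rows. -/
lemma even_card_perm_or_exists_odd_le [DecidableEq V] (hE : ∀ v, E v v) {S : Finset V}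
    (hS : S.Nonempty) :
    Even (Finset.univ.filter fun σ : Equiv.Perm V => ∀ v, E (σ v) v).card ∨
      ∃ i, Odd (S.filter fun j => E j i).card ∧ (S.filter fun j => E j i).card ≤
        (Finset.univ.filter fun σ : Equiv.Perm V => ∀ v, E (σ v) v).card := by
  let R := Relation.ReflTransGen E
  have htrans : ∀ {x y z}, R x y → R y z → R x z := fun h₁ h₂ => h₁.trans h₂
  obtain ⟨j₁, hj₁, hmin⟩ := Finset.exists_min_image S
    (fun j => (Finset.univ.filter fun x => R x j).card) hS
  have hback : ∀ j ∈ S, R j j₁ → R j₁ j := by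
    intro j hj hjj
    have hsub : (Finset.univ.filter fun x => R x j) ⊆ Finset.univ.filter fun x => R x j₁ := by
      intro x hx
      simp only [Finset.mem_filter, Finset.mem_univ, true_and] at hx ⊢
      exact htrans hx hjj
    have heq := Finset.eq_of_subset_of_card_le hsub (hmin j hj)
    have hmem : j₁ ∈ Finset.univ.filter fun x => R x j₁ := by
      simp only [Finset.mem_filter, Finset.mem_univ, true_and]
      exact .refl
    rw [← heq] at hmem
    exact (Finset.mem_filter.1 hmem).2
  have hcomp : ∀ i, R i j₁ → ∀ j ∈ S, E j i → R j j₁ ∧ R i j := by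
    intro i hi j hj hji
    have h1 : R j j₁ := .head hji hi
    exact ⟨h1, htrans hi (hback j hj h1)⟩
  by_cases hodd : ∃ i, R i j₁ ∧ Odd (S.filter fun j => E j i).card
  · obtain ⟨i, hi, hio⟩ := hodd
    refine Or.inr ⟨i, hio, ?_⟩
    refine (Finset.card_le_card (t := Finset.image (fun σ : Equiv.Perm V => σ i)
      (Finset.univ.filter fun σ : Equiv.Perm V => ∀ v, E (σ v) v)) fun j hj => ?_).trans
      Finset.card_image_le
    obtain ⟨hj, hji⟩ := Finset.mem_filter.1 hj
    obtain ⟨σ, rfl, hσ⟩ := exists_perm_of_reflTransGen hE (hcomp i hi j hj hji).2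
    refine Finset.mem_image.2 ⟨σ, Finset.mem_filter.2 ⟨Finset.mem_univ _, fun v => ?_⟩, rfl⟩
    by_cases hv : v = i
    · rwa [hv]
    · exact hσ v hv
  · push Not at hodd
    left
    have hdet : (Matrix.of fun j i => if E j i ∧ R i j then (1 : ZMod 2) else 0).det = 0 := by
      refine Matrix.det_eq_zero_of_vecMul_eq_zero
        (v := fun j => if j ∈ S ∧ R j j₁ then (1 : ZMod 2) else 0) (j := j₁) ?_
        (if_pos ⟨hj₁, .refl⟩)
      funext i
      simp only [Matrix.vecMul, dotProduct, Matrix.of_apply, Pi.zero_apply, mul_ite, mul_one,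
        mul_zero, ← ite_and]
      rw [Finset.sum_boole]
      by_cases hi : R i j₁
      · have hset : (Finset.univ.filter fun j => (E j i ∧ R i j) ∧ j ∈ S ∧ R j j₁) =
            S.filter fun j => E j i := by
          ext j
          simp only [Finset.mem_filter, Finset.mem_univ, true_and]
          exact ⟨fun hj => ⟨hj.2.1, hj.1.1⟩, fun hj =>
            ⟨⟨hj.2, (hcomp i hi j hj.1 hj.2).2⟩, hj.1, (hcomp i hi j hj.1 hj.2).1⟩⟩
        rw [hset, ZMod.natCast_eq_zero_iff_even]
        exact Nat.not_odd_iff_even.1 (hodd i hi)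
      · rw [Finset.filter_false_of_mem, Finset.card_empty, Nat.cast_zero]
        rintro j - ⟨⟨-, hij⟩, -, hj⟩
        exact hi (htrans hij hj)
    rw [← ZMod.natCast_eq_zero_iff_even, ← hdet, Matrix.det_apply', ← Finset.sum_boole]
    refine Finset.sum_congr rfl fun σ _ => ?_
    have hsign : ((Equiv.Perm.sign σ : ℤ) : ZMod 2) = 1 := by
      rcases Int.units_eq_one_or (Equiv.Perm.sign σ) with hσ | hσ
      · simp [hσ]
      · rw [hσ]; decide
    simp only [hsign, one_mul, Matrix.of_apply]
    rw [Finset.prod_ite_zero, Finset.prod_const_one]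
    by_cases hσ : ∀ v, E (σ v) v
    · rw [if_pos hσ, if_pos fun v _ => ⟨hσ v, reflTransGen_of_perm hσ v⟩]
    · rw [if_neg hσ, if_neg fun hσ' => hσ fun v => (hσ' v (Finset.mem_univ v)).1]

end TightPerm

/-- An element is equal to `1` or absorbed by `1`. -/
def LeOne {A : Type*} [CommSemiring A] (x : A) : Prop := x = 1 ∨ x + 1 = 1

namespace LeOne

variable {A : Type*} [CommSemiring A] {x y : A}

lemma mul (hx : LeOne x) (hy : LeOne y) : LeOne (x * y) := by
  rcases hx with rfl | hx
  · rwa [one_mul]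
  rcases hy with rfl | hy
  · rw [mul_one]; exact Or.inr hx
  · refine Or.inr ?_
    calc x * y + 1 = x * y + (x + 1) := by rw [hx]
      _ = x * (y + 1) + 1 := by ring
      _ = 1 := by rw [hy, mul_one, hx]

lemma prod {ι : Type*} (s : Finset ι) (f : ι → A) (hf : ∀ i ∈ s, LeOne (f i)) :
    LeOne (∏ i ∈ s, f i) :=
  Finset.prod_induction f LeOne (fun _ _ => mul) (Or.inl rfl) hf

lemma eq_one_of_mul_eq_one (hx : LeOne x) (hy : LeOne y) (hxy : x * y = 1) : x = 1 := by
  rcases hx with rfl | hx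
  · rfl
  rcases hy with rfl | hy
  · rwa [mul_one] at hxy
  · calc x = x * (y + 1) := by rw [hy, mul_one]
      _ = x * y + x := by ring
      _ = 1 := by rw [hxy, add_comm, hx]

lemma prod_eq_one_iff {ι : Type*} [DecidableEq ι] (s : Finset ι) (f : ι → A)
    (hf : ∀ i ∈ s, LeOne (f i)) : ∏ i ∈ s, f i = 1 ↔ ∀ i ∈ s, f i = 1 := by
  refine ⟨fun h i hi => ?_, Finset.prod_eq_one⟩
  rw [← Finset.mul_prod_erase _ _ hi] at h
  exact (hf i hi).eq_one_of_mul_eq_one (prod _ _ fun j hj => hf j (Finset.mem_of_mem_erase hj)) h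

open scoped Classical in
lemma sum_eq_card {ι : Type*} (s : Finset ι) (f : ι → A) (hf : ∀ i ∈ s, LeOne (f i))
    (hne : (s.filter fun i => f i = 1).Nonempty) :
    ∑ i ∈ s, f i = ((s.filter fun i => f i = 1).card : A) := by
  rw [← Finset.sum_filter_add_sum_filter_not s fun i => f i = 1,
    Finset.sum_congr rfl fun i hi => (Finset.mem_filter.1 hi).2, Finset.sum_const, nsmul_one]
  obtain ⟨c, hc⟩ := Nat.exists_eq_add_one.2 hne.card_pos
  rw [hc]
  refine Finset.sum_induction (fun i => f i) (fun y => ((c + 1 : ℕ) : A) + y = (c + 1 : ℕ))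
    (fun a b ha hb => by rw [← add_assoc, ha, hb]) (add_zero _) fun i hi => ?_
  obtain ⟨hi, hi1⟩ := Finset.mem_filter.1 hi
  rw [Nat.cast_succ, add_assoc, add_comm 1, (hf i hi).resolve_left hi1]

end LeOne

namespace IsMetaTangibleGroup

variable {A : Type*} [CommSemiring A] {n : A → A} {T : Set A}

lemma isTangibleOrder_of_bipotent (h : IsMetaTangibleGroup n T) (hn1 : n 1 = 1)
    (h3 : (1 : A) + 1 + 1 ∉ T) : IsTangibleOrder T fun x y => x = y ∨ x + y = y where
  trans x y z := by
    rintro (rfl | hxy)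
    · exact id
    rintro (rfl | hyz)
    · exact Or.inr hxy
    · exact Or.inr (by rw [← hyz, ← add_assoc, hxy])
  total x hx y hy := by
    rcases hx with rfl | hx
    · simp
    rcases hy with rfl | hy
    · simp
    have hn : ∀ z, n z = z := fun z => by rw [h.map_eq, hn1, one_mul]
    by_contra! hcon
    obtain ⟨⟨hxy, hy'⟩, -, hx'⟩ := hcon
    rw [add_comm] at hx'
    have key : ∀ a ∈ T, ∀ b ∈ T, a + b ∈ T → a + b ≠ a → b = (a + b) + a := by
      intro a ha b hb hab hne
      have h1 := h.add_mem _ hab a ha (by rw [hn]; exact hne.symm)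
      have h2 := h.unique _ h1 b hb ⟨a + b, by rw [hn]; ring⟩
      exact h2.trans (hn _)
    have hs := h.add_mem x hx y hy (by rw [hn]; exact hxy.symm)
    have hb := key x hx y hy hs hx'
    have ha := key y hy x hx (by rwa [add_comm]) (by rwa [add_comm])
    rw [add_comm y x] at ha
    have hsum : x + y = (x + y) * (1 + 1 + 1) := by
      calc x + y = (x + y + y) + (x + y + x) := by rw [← ha, ← hb]
        _ = _ := by ring
    obtain ⟨g, -, hg⟩ := h.exists_inv _ hs
    refine h3 ?_
    have h1 : (1 : A) + 1 + 1 = 1 := by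
      calc (1 : A) + 1 + 1 = (x + y) * g * (1 + 1 + 1) := by rw [hg, one_mul]
        _ = (x + y) * (1 + 1 + 1) * g := by ring
        _ = 1 := by rw [← hsum, hg]
    rw [h1]
    exact h.one_mem
  mul_right x y z _ := by
    rintro (rfl | hxy)
    · exact Or.inl rfl
    · exact Or.inr (by rw [← add_mul, hxy])
  eq_zero x := by simp

lemma detn_quasiZero_of_leOne (h : IsMetaTangibleGroup n T) (hn1 : n 1 = 1) {k : ℕ}
    (M : Matrix (Fin k) (Fin k) A) (J : Finset (Fin k)) (α : Fin k → A) (j₀ : Fin k)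
    (hM : ∀ i j, LeOne (M i j)) (hdiag : ∀ i, M i i = 1) (hj₀ : j₀ ∈ J) (hα₀ : α j₀ = 1)
    (hα : ∀ j ∈ J, LeOne (α j))
    (hdep : ∀ i, ∃ x, ∑ j ∈ J, α j * M j i = x + n x) : ∃ x, detn n M = x + n x := by
  classical
  have hn : ∀ z, n z = z := fun z => by rw [h.map_eq, hn1, one_mul]
  have hdet : detn n M =
      ((Finset.univ.filter fun σ : Equiv.Perm (Fin k) => ∀ v, M (σ v) v = 1).card : A) := by
    have hiff : ∀ σ : Equiv.Perm (Fin k), ∏ i, M (σ i) i = 1 ↔ ∀ v, M (σ v) v = 1 := fun σ => by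
      rw [LeOne.prod_eq_one_iff _ _ fun i _ => hM _ _]; simp
    have hsum := LeOne.sum_eq_card Finset.univ (fun σ : Equiv.Perm (Fin k) => ∏ i, M (σ i) i)
      (fun σ _ => LeOne.prod _ _ fun i _ => hM _ _)
      ⟨1, Finset.mem_filter.2 ⟨Finset.mem_univ _, Finset.prod_eq_one fun i _ => hdiag i⟩⟩
    simp only [hiff] at hsum
    rw [← hsum, h.detn_eq_sum]
    simp [negSign, hn1]
  have heven : ∀ m : ℕ, Even m → ∃ x : A, (m : A) = x + n x := by
    rintro _ ⟨m, rfl⟩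
    exact ⟨m, by rw [hn, Nat.cast_add]⟩
  rw [hdet]
  have hcount : Even (Finset.univ.filter fun σ : Equiv.Perm (Fin k) => ∀ v, M (σ v) v = 1).card ∨
      ∃ i, Odd ((J.filter fun j => α j = 1).filter fun j => M j i = 1).card ∧
        ((J.filter fun j => α j = 1).filter fun j => M j i = 1).card ≤
          (Finset.univ.filter fun σ : Equiv.Perm (Fin k) => ∀ v, M (σ v) v = 1).card := by
    convert even_card_perm_or_exists_odd_le (E := fun j i => M j i = 1) hdiag
      (S := J.filter fun j => α j = 1) ⟨j₀, Finset.mem_filter.2 ⟨hj₀, hα₀⟩⟩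
  rcases hcount with heN | ⟨i, hodd, hle⟩
  · exact heven _ heN
  have hset : (J.filter fun j => α j * M j i = 1) =
      (J.filter fun j => α j = 1).filter fun j => M j i = 1 := by
    rw [Finset.filter_filter]
    refine Finset.filter_congr fun j hj => ⟨fun hji => ?_, fun hji => by rw [hji.1, hji.2, one_mul]⟩
    exact ⟨(hα j hj).eq_one_of_mul_eq_one (hM j i) hji,
      (hM j i).eq_one_of_mul_eq_one (hα j hj) (by rwa [mul_comm])⟩
  have hsum := LeOne.sum_eq_card J (fun j => α j * M j i) (fun j hj => (hα j hj).mul (hM j i))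
    (by rw [hset, ← Finset.card_pos]; exact hodd.pos)
  obtain ⟨x, hx⟩ := hdep i
  rw [hsum, hset] at hx
  rcases Nat.even_or_odd
    (Finset.univ.filter fun σ : Equiv.Perm (Fin k) => ∀ v, M (σ v) v = 1).card with heN | hoN
  · exact heven _ heN
  obtain ⟨y, hy⟩ := heven _ (Nat.Odd.sub_odd hoN hodd)
  refine ⟨x + y, ?_⟩
  rw [h.map_add, add_add_add_comm, ← hx, ← hy, ← Nat.cast_add, Nat.add_sub_cancel' hle]

lemma add_add_one_eq_one (h : IsMetaTangibleGroup n T) (hn1 : n 1 = 1)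
    (h3 : (1 : A) + 1 + 1 ∈ T) : (1 : A) + 1 + 1 = 1 := by
  have h2 := h.unique _ h3 1 h.one_mem ⟨1 + 1, by rw [h.map_add, hn1]; ring⟩
  have h4 := congrArg n h2
  rw [h.map_map, hn1] at h4
  exact h4.symm

lemma one_add_add_map_one (h : IsMetaTangibleGroup n T) (hn1 : n 1 ≠ 1) (h11 : (1 : A) + 1 ≠ 1) :
    1 + (1 + n 1) = 1 := by
  have h2 := h.add_mem 1 h.one_mem 1 h.one_mem hn1.symm
  have hc : 1 + 1 + n 1 ∈ T := h.add_mem _ h2 _ (h.map_mem 1 h.one_mem) fun e => h11 (by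
    have h3 := congrArg n e
    rw [h.map_map, h.map_map] at h3
    exact h3.symm)
  have h3 := h.unique _ hc _ (h.map_mem 1 h.one_mem) ⟨1 + 1, by rw [h.map_add]; ring⟩
  have h4 := congrArg n h3
  rw [h.map_map, h.map_map] at h4
  rw [← add_assoc, ← h4]

lemma detn_quasiZero (h : IsMetaTangibleGroup n T) {k : ℕ} (M : Matrix (Fin k) (Fin k) A)
    (J : Finset (Fin k)) (hJ : J.Nonempty) (α : Fin k → A)
    (hM : ∀ i j, M i j ∈ insert 0 T) (hα : ∀ j ∈ J, α j ∈ T)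
    (hdep : ∀ i, ∃ x, ∑ j ∈ J, α j * M j i = x + n x) : ∃ x, detn n M = x + n x := by
  have hsize : ∀ {x : A}, (x = 0 ∨ ((1 : A) ≠ 0 ∧ x * (1 + n 1) + 1 * (1 + n 1) = 1 * (1 + n 1))) →
      x * (1 + n 1) + (1 + n 1) = 1 + n 1 := by
    rintro x (rfl | ⟨-, hx⟩)
    · rw [zero_mul, zero_add]
    · simpa only [one_mul] using hx
  have residue : 1 + (1 + n 1) = 1 → ∃ x, detn n M = x + n x := by
    intro h1
    have hee : (1 + n 1) + (1 + n 1) = 1 + n 1 := by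
      rw [add_right_comm, h1]
    exact (h.isTangibleOrder_of_idem hee).detn_quasiZero_of_normalized h
      (fun M J α j₀ _ hM1 hdiag hj₀ hα₀ _ hα1 hdep => h.detn_quasiZero_of_residue h1 hee M J α j₀
        (fun i j => hsize (hM1 i j)) hdiag hj₀ hα₀ (fun j hj => hsize (hα1 j hj)) hdep)
      M J hJ α hM hα hdep
  by_cases hn1 : n 1 = 1
  · by_cases h3 : (1 : A) + 1 + 1 ∈ T
    · exact residue (by rw [hn1, ← add_assoc, h.add_add_one_eq_one hn1 h3])
    · exact (h.isTangibleOrder_of_bipotent hn1 h3).detn_quasiZero_of_normalized h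
        (fun M J α j₀ _ hM1 hdiag hj₀ hα₀ _ hα1 hdep => h.detn_quasiZero_of_leOne hn1 M J α j₀
          hM1 hdiag hj₀ hα₀ hα1 hdep) M J hJ α hM hα hdep
  · by_cases h11 : (1 : A) + 1 = 1
    · have hee : (1 + n 1) + (1 + n 1) = 1 + n 1 := by
        rw [add_add_add_comm, ← h.map_add, h11]
      exact (h.isTangibleOrder_of_idem hee).detn_quasiZero_of_normalized h
        (fun M J α j₀ hMT hM1 hdiag hj₀ hα₀ hαT hα1 hdep => h.detn_quasiZero_of_signed h11 hn1
          M J α j₀ hMT (fun i j => hsize (hM1 i j)) hdiag hj₀ hα₀ hαT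
          (fun j hj => hsize (hα1 j hj)) hdep) M J hJ α hM hα hdep
    · exact residue (h.one_add_add_map_one hn1 h11)

end IsMetaTangibleGroup

/-- Theorem 9.4: if the rows of a tangible k×k matrix over a cancelative
meta-tangible triple are ∘-dependent, then its (−)-determinant is a quasi-zero. -/
theorem stmt7 {A : Type*} [CommSemiring A] (n : A → A) (T : Set A)
    (hadd : ∀ x y : A, n (x + y) = n x + n y)
    (hinv : ∀ x : A, n (n x) = x)
    (hmul : ∀ x y : A, n (x * y) = n x * y)
    (hone : (1 : A) ∈ T)
    (hTmul : ∀ a ∈ T, ∀ b ∈ T, a * b ∈ T)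
    (hTn : ∀ a ∈ T, n a ∈ T)
    (hdisj : ∀ a ∈ T, ¬ ∃ x : A, a = x + n x)
    (hgen : ∀ c : A, c ≠ 0 → ∃ l : List A, (∀ x ∈ l, x ∈ T) ∧ l.sum = c)
    (huq : ∀ a ∈ T, ∀ b ∈ T, (∃ x : A, a + b = x + n x) → b = n a)
    (hmt : ∀ a ∈ T, ∀ b ∈ T, b ≠ n a → a + b ∈ T)
    (hgrp : ∀ t ∈ T, ∃ s ∈ T, t * s = 1)
    (k : ℕ) (M : Matrix (Fin k) (Fin k) A)
    (hM : ∀ i j : Fin k, M i j ∈ T ∨ M i j = 0)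
    (J : Finset (Fin k)) (hJ : J.Nonempty) (α : Fin k → A)
    (hα : ∀ j ∈ J, α j ∈ T)
    (hdep : ∀ i : Fin k, ∃ x : A, (∑ j ∈ J, α j * M j i) = x + n x) :
    ∃ x : A, detn n M = x + n x := by
  have h : IsMetaTangibleGroup n T :=
    ⟨hadd, hinv, hmul, hone, hTmul, hTn, hdisj, huq, hmt, hgrp⟩
  exact h.detn_quasiZero M J hJ α (fun i j => (hM i j).symm) hα hdep
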